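/- arXiv:2503.00141 — 2 statements merged into one kernel-verified Lean document; each statement's English description precedes it below -/
import Mathlib

section
/- Let δ₁ = diag(1,1,t) ∈ GL_3(F), Q₁ = {[[1,0,a],[0,1,b],[0,0,t]] : a,b ∈ 𝔽_q}, R₁ = {[[1,a,0],[0,0,1],[0,t,0]] : a ∈ 𝔽_q}, and S₁ = {[[0,1,0],[0,0,1],[t,0,0]]}. Then: (i) for each Γ ∈ {Γ_1(t), Γ_0(t), Γ_0^P}, the double coset Γδ₁Γ is the disjoint union of the q² pairwise distinct left cosets Γε, ε ∈ Q₁; (ii) Γ_2^P δ₁ Γ_2^P is the disjoint union of the q²+q pairwise distinct left cosets Γ_2^P ε, ε ∈ Q₁ ∪ R₁; (iii) GL_3(A) δ₁ GL_3(A) is the disjoint union of the q²+q+1 pairwise distinct left cosets GL_3(A) ε, ε ∈ Q₁ ∪ R₁ ∪ S₁. -/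
noncomputable section

variable (Fq : Type) [Field Fq] [Fintype Fq]

local notation "A" => Polynomial Fq
local notation "F" => RatFunc Fq

/-- `t` as an element of `F = 𝔽_q(t)`. -/
def tF : RatFunc Fq := algebraMap (Polynomial Fq) (RatFunc Fq) Polynomial.X

/-- Constants `𝔽_q ⊂ F`. -/
def cF (a : Fq) : RatFunc Fq := algebraMap Fq (RatFunc Fq) a

/-- The subgroup of `GL_3(F)` (described as a set of matrices over `F`) consisting of the
invertible matrices over `A = 𝔽_q[t]` (i.e. with determinant in `𝔽_q^×`) whose reduction
modulo `t` satisfies the predicate `P`. -/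
def levelSet (P : Matrix (Fin 3) (Fin 3) Fq → Prop) :
    Set (Matrix (Fin 3) (Fin 3) (RatFunc Fq)) :=
  {x | ∃ γ : Matrix (Fin 3) (Fin 3) (Polynomial Fq), IsUnit γ.det ∧
    P (γ.map (Polynomial.evalRingHom (0 : Fq))) ∧
    x = γ.map (algebraMap (Polynomial Fq) (RatFunc Fq))}

/-- `Γ₁(t)`: reduction modulo `t` unipotent upper triangular. -/
def G1 : Set (Matrix (Fin 3) (Fin 3) (RatFunc Fq)) :=
  levelSet Fq fun m => (∀ i j : Fin 3, j < i → m i j = 0) ∧ ∀ i, m i i = 1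

/-- `Γ₀(t)`: reduction modulo `t` upper triangular. -/
def G0 : Set (Matrix (Fin 3) (Fin 3) (RatFunc Fq)) :=
  levelSet Fq fun m => ∀ i j : Fin 3, j < i → m i j = 0

/-- `Γ₀ᴾ`: reduction modulo `t` with vanishing `(3,1)`- and `(3,2)`-entries. -/
def G0P : Set (Matrix (Fin 3) (Fin 3) (RatFunc Fq)) :=
  levelSet Fq fun m => m 2 0 = 0 ∧ m 2 1 = 0

/-- `Γ₂ᴾ`: reduction modulo `t` with vanishing `(2,1)`- and `(3,1)`-entries. -/
def G2P : Set (Matrix (Fin 3) (Fin 3) (RatFunc Fq)) :=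
  levelSet Fq fun m => m 1 0 = 0 ∧ m 2 0 = 0

/-- `GL_3(A)`. -/
def GLA : Set (Matrix (Fin 3) (Fin 3) (RatFunc Fq)) :=
  levelSet Fq fun _ => True

/-- The double coset `ΓδΓ`. -/
def dcoset (Γ : Set (Matrix (Fin 3) (Fin 3) (RatFunc Fq)))
    (δ : Matrix (Fin 3) (Fin 3) (RatFunc Fq)) : Set (Matrix (Fin 3) (Fin 3) (RatFunc Fq)) :=
  {x | ∃ g ∈ Γ, ∃ g' ∈ Γ, x = g * δ * g'}

/-- The left coset `Γε`. -/
def lcoset (Γ : Set (Matrix (Fin 3) (Fin 3) (RatFunc Fq)))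
    (ε : Matrix (Fin 3) (Fin 3) (RatFunc Fq)) : Set (Matrix (Fin 3) (Fin 3) (RatFunc Fq)) :=
  {x | ∃ g ∈ Γ, x = g * ε}

/-- `δ₁ = diag(1,1,t)`. -/
def delta1 : Matrix (Fin 3) (Fin 3) (RatFunc Fq) := Matrix.diagonal ![1, 1, tF Fq]

/-- The family `Q₁`, indexed by `(a,b) ∈ 𝔽_q × 𝔽_q`. -/
def epsQ1 (p : Fq × Fq) : Matrix (Fin 3) (Fin 3) (RatFunc Fq) :=
  Matrix.of ![![1, 0, cF Fq p.1], ![0, 1, cF Fq p.2], ![0, 0, tF Fq]]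

/-- The family `R₁`, indexed by `a ∈ 𝔽_q`. -/
def epsR1 (a : Fq) : Matrix (Fin 3) (Fin 3) (RatFunc Fq) :=
  Matrix.of ![![1, cF Fq a, 0], ![0, 0, 1], ![0, tF Fq, 0]]

/-- The single element of `S₁`. -/
def epsS1 : Matrix (Fin 3) (Fin 3) (RatFunc Fq) :=
  Matrix.of ![![0, 1, 0], ![0, 0, 1], ![tF Fq, 0, 0]]

/-- A family of matrices decomposes the set `D` as a disjoint union of the `q²` (resp. …)
pairwise distinct left `Γ`-cosets of its members. -/
def IsDisjointCosetDecomp {ι : Type} (Γ : Set (Matrix (Fin 3) (Fin 3) (RatFunc Fq)))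
    (D : Set (Matrix (Fin 3) (Fin 3) (RatFunc Fq)))
    (fam : ι → Matrix (Fin 3) (Fin 3) (RatFunc Fq)) : Prop :=
  (D = ⋃ i : ι, lcoset Fq Γ (fam i)) ∧
    Function.Injective (fun i : ι => lcoset Fq Γ (fam i)) ∧
    Pairwise (Function.onFun Disjoint fun i : ι => lcoset Fq Γ (fam i))

open Polynomial Matrix

section Decomposition

omit [Fintype Fq]

/-- `δ₁` as a matrix over `𝔽_q[t]`. -/
def polyDelta1 : Matrix (Fin 3) (Fin 3) (Polynomial Fq) := diagonal ![1, 1, X]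

theorem map_polyDelta1 :
    (polyDelta1 Fq).map (algebraMap (Polynomial Fq) (RatFunc Fq)) = delta1 Fq := by
  ext i j
  fin_cases i <;> fin_cases j <;> simp [polyDelta1, delta1, tF]

theorem map_algebraMap_injective : Function.Injective
    fun γ : Matrix (Fin 3) (Fin 3) (Polynomial Fq) =>
      γ.map (algebraMap (Polynomial Fq) (RatFunc Fq)) :=
  Matrix.map_injective (IsFractionRing.injective (Polynomial Fq) (RatFunc Fq))

variable {Fq}

theorem map_C_map_eval_zero (m : Matrix (Fin 3) (Fin 3) Fq) :
    (m.map C).map (evalRingHom (0 : Fq)) = m := by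
  ext i j
  simp

theorem map_C_mul_map_C {m n : Matrix (Fin 3) (Fin 3) Fq} (h : m * n = 1) :
    m.map C * n.map C = 1 := by
  rw [← Matrix.map_mul, h, Matrix.map_one _ C.map_zero C.map_one]

theorem isUnit_det_map_C {m n : Matrix (Fin 3) (Fin 3) Fq} (h : m * n = 1) :
    IsUnit (m.map C).det :=
  IsUnit.of_mul_eq_one (n.map C).det (by rw [← det_mul, map_C_mul_map_C h, det_one])

/-- A polynomial matrix whose `(1,3)`- and `(2,3)`-entries vanish modulo `t` stays integral
after conjugation by `δ₁`. -/
theorem exists_polyDelta1_mul_eq (k : Matrix (Fin 3) (Fin 3) (Polynomial Fq))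
    (h0 : (k 0 2).eval 0 = 0) (h1 : (k 1 2).eval 0 = 0) :
    ∃ n : Matrix (Fin 3) (Fin 3) (Polynomial Fq), polyDelta1 Fq * k = n * polyDelta1 Fq ∧
      n.det = k.det ∧ n 0 0 = k 0 0 ∧ n 0 1 = k 0 1 ∧ n 1 0 = k 1 0 ∧ n 1 1 = k 1 1 ∧
      n 2 2 = k 2 2 ∧ n 2 0 = X * k 2 0 ∧ n 2 1 = X * k 2 1 := by
  rw [← coeff_zero_eq_eval_zero, ← X_dvd_iff] at h0 h1
  obtain ⟨a, ha⟩ := h0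
  obtain ⟨b, hb⟩ := h1
  refine ⟨!![k 0 0, k 0 1, a; k 1 0, k 1 1, b; X * k 2 0, X * k 2 1, k 2 2],
    ?_, ?_, ?_⟩
  · ext i j : 2
    fin_cases i <;> fin_cases j <;>
      simp [polyDelta1, ha, hb, mul_comm]
  · simp only [det_fin_three, ha, hb]
    simp
    ring
  · simp

variable {ι : Type} {P : Matrix (Fin 3) (Fin 3) Fq → Prop}
  {u v : ι → Matrix (Fin 3) (Fin 3) Fq}

/-- Left coset decomposition of `Γδ₁Γ` for the level group `Γ` of a predicate `P`, from a
system `u` of matrices over `𝔽_q` (with inverses `v`) representing the possible third columns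
of inverses of matrices satisfying `P`. -/
theorem isDisjointCosetDecomp_levelSet
    (hmul : ∀ m n, P m → P n → P (m * n))
    (hconj : ∀ m n, P m → n 0 0 = m 0 0 → n 0 1 = m 0 1 → n 1 0 = m 1 0 → n 1 1 = m 1 1 →
      n 2 2 = m 2 2 → n 2 0 = 0 → n 2 1 = 0 → P n)
    (huv : ∀ i, u i * v i = 1) (hu : ∀ i, P (u i)) (hv : ∀ i, P (v i))
    (hex : ∀ m, P m → m.det ≠ 0 → ∃ i, (m * v i) 0 2 = 0 ∧ (m * v i) 1 2 = 0)
    (huniq : ∀ i j, (u i * v j) 0 2 = 0 → (u i * v j) 1 2 = 0 → i = j)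
    {fam : ι → Matrix (Fin 3) (Fin 3) (RatFunc Fq)}
    (hfam : ∀ i, fam i = delta1 Fq * (u i).map (cF Fq)) :
    IsDisjointCosetDecomp Fq (levelSet Fq P) (dcoset Fq (levelSet Fq P) (delta1 Fq)) fam := by
  have hvu : ∀ i, v i * u i = 1 := fun i => mul_eq_one_comm.1 (huv i)
  have hfam' : ∀ i, fam i =
      (polyDelta1 Fq * (u i).map C).map (algebraMap (Polynomial Fq) (RatFunc Fq)) := by
    intro i
    rw [hfam, Matrix.map_mul, map_polyDelta1, Matrix.map_map]
    rfl
  have hmem : ∀ i, (u i).map (cF Fq) ∈ levelSet Fq P := fun i =>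
    ⟨(u i).map C, isUnit_det_map_C (huv i), by rw [map_C_map_eval_zero]; exact hu i, by
      rw [Matrix.map_map]; rfl⟩
  have hdisj : ∀ i j x, x ∈ lcoset Fq (levelSet Fq P) (fam i) →
      x ∈ lcoset Fq (levelSet Fq P) (fam j) → i = j := by
    rintro i j x ⟨_, ⟨γ, hγ, -, rfl⟩, rfl⟩ ⟨_, ⟨γ', -, -, rfl⟩, h⟩
    rw [hfam', hfam', ← Matrix.map_mul, ← Matrix.map_mul] at h
    replace h := map_algebraMap_injective Fq h
    have h2 : polyDelta1 Fq * (u i * v j).map C = γ⁻¹ * γ' * polyDelta1 Fq := by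
      calc _ = γ⁻¹ * (γ * (polyDelta1 Fq * (u i).map C)) * (v j).map C := by
              rw [← Matrix.mul_assoc γ⁻¹, nonsing_inv_mul _ hγ, Matrix.one_mul,
                Matrix.map_mul, Matrix.mul_assoc]
        _ = _ := by
              rw [h]
              simp only [Matrix.mul_assoc]
              rw [map_C_mul_map_C (huv j), Matrix.mul_one]
    have key : ∀ l : Fin 3, l ≠ 2 → (u i * v j) l 2 = 0 := by
      intro l hl
      have h3 := congrArg (eval 0) (congrFun (congrFun h2 l) 2)
      rw [polyDelta1, diagonal_mul, mul_diagonal] at h3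
      fin_cases l <;> simp_all
    exact huniq i j (key 0 (by decide)) (key 1 (by decide))
  refine ⟨?_, ?_, ?_⟩
  · ext x
    rw [Set.mem_iUnion]
    constructor
    · rintro ⟨_, ⟨γ, hγ, hPγ, rfl⟩, _, ⟨γ', hγ', hPγ', rfl⟩, rfl⟩
      have hdet : (γ'.map (evalRingHom (0 : Fq))).det ≠ 0 := by
        have := hγ'.map (evalRingHom (0 : Fq))
        rw [RingHom.map_det] at this
        exact this.ne_zero
      obtain ⟨i, hi0, hi1⟩ := hex _ hPγ' hdet
      have hk : (γ' * (v i).map C).map (evalRingHom (0 : Fq)) =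
          γ'.map (evalRingHom (0 : Fq)) * v i := by
        rw [Matrix.map_mul, map_C_map_eval_zero]
      have hke : ∀ a b, ((γ' * (v i).map C) a b).eval 0 =
          (γ'.map (evalRingHom (0 : Fq)) * v i) a b := fun a b => by
        rw [← hk]; rfl
      obtain ⟨n, hn, hndet, n00, n01, n10, n11, n22, n20, n21⟩ :=
        exists_polyDelta1_mul_eq (γ' * (v i).map C) (by rw [hke, hi0]) (by rw [hke, hi1])
      have hPn : P (n.map (evalRingHom (0 : Fq))) := by
        refine hconj ((γ' * (v i).map C).map (evalRingHom (0 : Fq))) _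
          (hk ▸ hmul _ _ hPγ' (hv i)) ?_ ?_ ?_ ?_ ?_ ?_ ?_ <;>
          simp only [Matrix.map_apply, coe_evalRingHom, n00, n01, n10, n11, n22, n20, n21,
            eval_mul, eval_X, zero_mul]
      refine ⟨i, _, ⟨γ * n, ?_, ?_, rfl⟩, ?_⟩
      · rw [det_mul, hndet, det_mul]
        exact hγ.mul (hγ'.mul (isUnit_det_map_C (hvu i)))
      · rw [Matrix.map_mul]
        exact hmul _ _ hPγ hPn
      · rw [hfam', ← map_polyDelta1, ← Matrix.map_mul, ← Matrix.map_mul, ← Matrix.map_mul,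
          Matrix.mul_assoc γ n, ← Matrix.mul_assoc n, ← hn]
        simp only [Matrix.mul_assoc]
        rw [map_C_mul_map_C (hvu i), Matrix.mul_one]
    · rintro ⟨i, g, hg, rfl⟩
      exact ⟨g, hg, _, hmem i, by rw [hfam, Matrix.mul_assoc]⟩
  · intro i j h
    have hi : (u i).map (cF Fq) * fam i ∈ lcoset Fq (levelSet Fq P) (fam i) := ⟨_, hmem i, rfl⟩
    exact hdisj i j _ hi (Eq.subset h hi)
  · intro i j hij
    exact Set.disjoint_left.2 fun x hi hj => hij (hdisj i j x hi hj)

/-- The factor `u` in `ε = δ₁u` for `ε ∈ Q₁`. -/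
def factorQ1 (p : Fq × Fq) : Matrix (Fin 3) (Fin 3) Fq := !![1, 0, p.1; 0, 1, p.2; 0, 0, 1]

/-- The inverse of `factorQ1`. -/
def factorInvQ1 (p : Fq × Fq) : Matrix (Fin 3) (Fin 3) Fq :=
  !![1, 0, -p.1; 0, 1, -p.2; 0, 0, 1]

/-- The factor `u` in `ε = δ₁u` for `ε ∈ R₁`. -/
def factorR1 (a : Fq) : Matrix (Fin 3) (Fin 3) Fq := !![1, a, 0; 0, 0, 1; 0, 1, 0]

/-- The inverse of `factorR1`. -/
def factorInvR1 (a : Fq) : Matrix (Fin 3) (Fin 3) Fq := !![1, 0, -a; 0, 0, 1; 0, 1, 0]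

variable (Fq) in
/-- The factor `u` in `ε = δ₁u` for `ε ∈ S₁`. -/
def factorS1 : Matrix (Fin 3) (Fin 3) Fq := !![0, 1, 0; 0, 0, 1; 1, 0, 0]

variable (Fq) in
/-- The inverse of `factorS1`. -/
def factorInvS1 : Matrix (Fin 3) (Fin 3) Fq := !![0, 0, 1; 1, 0, 0; 0, 1, 0]

theorem factorQ1_mul_inv (p : Fq × Fq) : factorQ1 p * factorInvQ1 p = 1 := by
  ext i j
  fin_cases i <;> fin_cases j <;> simp [factorQ1, factorInvQ1, mul_apply, Fin.sum_univ_three]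

theorem factorR1_mul_inv (a : Fq) : factorR1 a * factorInvR1 a = 1 := by
  ext i j
  fin_cases i <;> fin_cases j <;> simp [factorR1, factorInvR1, mul_apply, Fin.sum_univ_three]

theorem factorS1_mul_inv : factorS1 Fq * factorInvS1 Fq = 1 := by
  ext i j
  fin_cases i <;> fin_cases j <;> simp [factorS1, factorInvS1, mul_apply, Fin.sum_univ_three]

theorem epsQ1_eq (p : Fq × Fq) : epsQ1 Fq p = delta1 Fq * (factorQ1 p).map (cF Fq) := by
  ext i j
  fin_cases i <;> fin_cases j <;> simp [factorQ1, epsQ1, delta1, cF]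

theorem epsR1_eq (a : Fq) : epsR1 Fq a = delta1 Fq * (factorR1 a).map (cF Fq) := by
  ext i j
  fin_cases i <;> fin_cases j <;> simp [factorR1, epsR1, delta1, cF]

theorem epsS1_eq : epsS1 Fq = delta1 Fq * (factorS1 Fq).map (cF Fq) := by
  ext i j
  fin_cases i <;> fin_cases j <;> simp [factorS1, epsS1, delta1, cF]

theorem exists_mul_factorInvQ1 (m : Matrix (Fin 3) (Fin 3) Fq)
    (h : m 0 0 * m 1 1 - m 0 1 * m 1 0 ≠ 0) :
    ∃ p : Fq × Fq, (m * factorInvQ1 p) 0 2 = 0 ∧ (m * factorInvQ1 p) 1 2 = 0 := by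
  obtain ⟨d, hd⟩ : ∃ d, (m 0 0 * m 1 1 - m 0 1 * m 1 0) * d = 1 := ⟨_, mul_inv_cancel₀ h⟩
  refine ⟨((m 0 2 * m 1 1 - m 0 1 * m 1 2) * d, (m 0 0 * m 1 2 - m 0 2 * m 1 0) * d), ?_, ?_⟩ <;>
    simp [factorInvQ1, mul_apply, Fin.sum_univ_three]
  · linear_combination -m 0 2 * hd
  · linear_combination -m 1 2 * hd

theorem exists_mul_factorInvR1 (m : Matrix (Fin 3) (Fin 3) Fq)
    (h : m 0 0 * m 1 1 - m 0 1 * m 1 0 = 0) (h' : m 0 0 * m 1 2 - m 0 2 * m 1 0 ≠ 0) :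
    ∃ a : Fq, (m * factorInvR1 a) 0 2 = 0 ∧ (m * factorInvR1 a) 1 2 = 0 := by
  obtain ⟨d, hd⟩ : ∃ d, (m 0 0 * m 1 2 - m 0 2 * m 1 0) * d = 1 := ⟨_, mul_inv_cancel₀ h'⟩
  refine ⟨(m 0 1 * m 1 2 - m 0 2 * m 1 1) * d, ?_, ?_⟩ <;>
    simp [factorInvR1, mul_apply, Fin.sum_univ_three]
  · linear_combination d * m 0 2 * h - m 0 1 * hd
  · linear_combination d * m 1 2 * h - m 1 1 * hd

theorem mul_factorInvS1 (m : Matrix (Fin 3) (Fin 3) Fq) (hm : m.det ≠ 0)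
    (h : m 0 0 * m 1 1 - m 0 1 * m 1 0 = 0) (h' : m 0 0 * m 1 2 - m 0 2 * m 1 0 = 0) :
    (m * factorInvS1 Fq) 0 2 = 0 ∧ (m * factorInvS1 Fq) 1 2 = 0 := by
  have hc : m 0 1 * m 1 2 - m 0 2 * m 1 1 ≠ 0 := by
    intro hc
    apply hm
    rw [det_fin_three]
    linear_combination m 2 2 * h - m 2 1 * h' + m 2 0 * hc
  constructor <;> simp [factorInvS1, mul_apply, Fin.sum_univ_three] <;>
    refine (mul_eq_zero_iff_right hc).1 ?_
  · linear_combination m 0 1 * h' - m 0 2 * h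
  · linear_combination m 1 1 * h' - m 1 2 * h

theorem eq_of_factorQ1_mul_inv (p r : Fq × Fq) (h0 : (factorQ1 p * factorInvQ1 r) 0 2 = 0)
    (h1 : (factorQ1 p * factorInvQ1 r) 1 2 = 0) : p = r := by
  simp [factorQ1, factorInvQ1, mul_apply, Fin.sum_univ_three] at h0 h1
  exact Prod.ext (by linear_combination h0) (by linear_combination h1)

/-- The decomposition for level groups contained in `Γ₀ᴾ`. -/
theorem isDisjointCosetDecomp_epsQ1
    (hmul : ∀ m n, P m → P n → P (m * n))
    (hconj : ∀ m n, P m → n 0 0 = m 0 0 → n 0 1 = m 0 1 → n 1 0 = m 1 0 → n 1 1 = m 1 1 →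
      n 2 2 = m 2 2 → n 2 0 = 0 → n 2 1 = 0 → P n)
    (hu : ∀ p, P (factorQ1 p)) (hv : ∀ p, P (factorInvQ1 p))
    (hP : ∀ m, P m → m 2 0 = 0 ∧ m 2 1 = 0) :
    IsDisjointCosetDecomp Fq (levelSet Fq P) (dcoset Fq (levelSet Fq P) (delta1 Fq))
      (epsQ1 Fq) := by
  refine isDisjointCosetDecomp_levelSet hmul hconj factorQ1_mul_inv hu hv ?_
    eq_of_factorQ1_mul_inv epsQ1_eq
  intro m hm hdet
  obtain ⟨h0, h1⟩ := hP m hm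
  refine exists_mul_factorInvQ1 m fun h => hdet ?_
  rw [det_fin_three, h0, h1]
  linear_combination m 2 2 * h

end Decomposition

/-- Decomposition of the double coset `Γδ₁Γ` into left cosets:
for `Γ ∈ {Γ₁(t), Γ₀(t), Γ₀ᴾ}` the `q²` cosets indexed by `Q₁`; for `Γ₂ᴾ` the `q²+q`
cosets indexed by `Q₁ ∪ R₁`; for `GL_3(A)` the `q²+q+1` cosets indexed by
`Q₁ ∪ R₁ ∪ S₁`. -/
theorem hecke_coset_reps_delta1 :
    (∀ Γ ∈ ({G1 Fq, G0 Fq, G0P Fq} : Set (Set (Matrix (Fin 3) (Fin 3) (RatFunc Fq)))),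
      IsDisjointCosetDecomp Fq Γ (dcoset Fq Γ (delta1 Fq)) (epsQ1 Fq)) ∧
    IsDisjointCosetDecomp Fq (G2P Fq) (dcoset Fq (G2P Fq) (delta1 Fq))
      (Sum.elim (epsQ1 Fq) (epsR1 Fq)) ∧
    IsDisjointCosetDecomp Fq (GLA Fq) (dcoset Fq (GLA Fq) (delta1 Fq))
      (Sum.elim (Sum.elim (epsQ1 Fq) (epsR1 Fq)) (fun _ : Unit => epsS1 Fq)) := by
  refine ⟨?_, ?_, ?_⟩
  · rintro Γ (rfl | rfl | rfl) <;> refine isDisjointCosetDecomp_epsQ1 ?_ ?_ ?_ ?_ ?_ <;>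
      simp +contextual [Fin.forall_fin_succ, factorQ1, factorInvQ1, mul_apply,
        Fin.sum_univ_three]
  · refine isDisjointCosetDecomp_levelSet (u := Sum.elim factorQ1 factorR1)
      (v := Sum.elim factorInvQ1 factorInvR1) ?_ ?_ ?_ ?_ ?_ ?_ ?_ ?_
    · simp +contextual [mul_apply, Fin.sum_univ_three]
    · simp +contextual
    · rintro (p | a)
      exacts [factorQ1_mul_inv p, factorR1_mul_inv a]
    · rintro (p | a) <;> simp [factorQ1, factorR1]
    · rintro (p | a) <;> simp [factorInvQ1, factorInvR1]
    · rintro m ⟨h0, h1⟩ hdet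
      by_cases h : m 0 0 * m 1 1 - m 0 1 * m 1 0 = 0
      · obtain ⟨a, ha⟩ := exists_mul_factorInvR1 m h fun h' => hdet (by
          rw [det_fin_three, h0, h1]
          rw [h0] at h h'
          linear_combination m 2 2 * h - m 2 1 * h')
        exact ⟨.inr a, ha⟩
      · obtain ⟨p, hp⟩ := exists_mul_factorInvQ1 m h
        exact ⟨.inl p, hp⟩
    · rintro (p | a) (r | b) h0 h1
      · rw [eq_of_factorQ1_mul_inv p r h0 h1]
      all_goals
        simp [factorQ1, factorInvQ1, factorR1, factorInvR1, mul_apply, Fin.sum_univ_three]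
          at h0 h1
      · rw [show a = b by linear_combination h0]
    · rintro (p | a)
      exacts [epsQ1_eq p, epsR1_eq a]
  · refine isDisjointCosetDecomp_levelSet
      (u := Sum.elim (Sum.elim factorQ1 factorR1) fun _ => factorS1 Fq)
      (v := Sum.elim (Sum.elim factorInvQ1 factorInvR1) fun _ => factorInvS1 Fq)
      (fun _ _ _ _ => trivial) (fun _ _ _ _ _ _ _ _ _ _ => trivial) ?_ (fun _ => trivial)
      (fun _ => trivial) ?_ ?_ ?_
    · rintro ((p | a) | _)
      exacts [factorQ1_mul_inv p, factorR1_mul_inv a, factorS1_mul_inv]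
    · rintro m - hdet
      by_cases h : m 0 0 * m 1 1 - m 0 1 * m 1 0 = 0
      · by_cases h' : m 0 0 * m 1 2 - m 0 2 * m 1 0 = 0
        · exact ⟨.inr (), mul_factorInvS1 m hdet h h'⟩
        · obtain ⟨a, ha⟩ := exists_mul_factorInvR1 m h h'
          exact ⟨.inl (.inr a), ha⟩
      · obtain ⟨p, hp⟩ := exists_mul_factorInvQ1 m h
        exact ⟨.inl (.inl p), hp⟩
    · rintro ((p | a) | _) ((r | b) | _) h0 h1
      · rw [eq_of_factorQ1_mul_inv p r h0 h1]
      all_goals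
        simp [factorQ1, factorInvQ1, factorR1, factorInvR1, factorS1, factorInvS1, mul_apply,
          Fin.sum_univ_three] at h0 h1
      · rw [show a = b by linear_combination h0]
      · rfl
    · rintro ((p | a) | _)
      exacts [epsQ1_eq p, epsR1_eq a, epsS1_eq]

end
end

section
/- Let δ₂ = diag(1,t,t) ∈ GL_3(F), Q₂ = {[[1,a,b],[0,t,0],[0,0,t]] : a,b ∈ 𝔽_q}, R₂ = {[[0,1,a],[t,0,0],[0,0,t]] : a ∈ 𝔽_q}, and S₂ = {[[0,0,1],[t,0,0],[0,t,0]]}. Then: (i) for each Γ ∈ {Γ_1(t), Γ_0(t), Γ_2^P}, the double coset Γδ₂Γ is the disjoint union of the q² pairwise distinct left cosets Γε, ε ∈ Q₂; (ii) Γ_0^P δ₂ Γ_0^P is the disjoint union of the q²+q pairwise distinct left cosets Γ_0^P ε, ε ∈ Q₂ ∪ R₂; (iii) GL_3(A) δ₂ GL_3(A) is the disjoint union of the q²+q+1 pairwise distinct left cosets GL_3(A) ε, ε ∈ Q₂ ∪ R₂ ∪ S₂. -/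
noncomputable section

variable (Fq : Type) [Field Fq] [Fintype Fq]

local notation "A" => Polynomial Fq
local notation "F" => RatFunc Fq

/-- `δ₂ = diag(1,t,t)`. -/
def delta2 : Matrix (Fin 3) (Fin 3) (RatFunc Fq) := Matrix.diagonal ![1, tF Fq, tF Fq]

/-- The family `Q₂`, indexed by `(a,b) ∈ 𝔽_q × 𝔽_q`. -/
def epsQ2 (p : Fq × Fq) : Matrix (Fin 3) (Fin 3) (RatFunc Fq) :=
  Matrix.of ![![1, cF Fq p.1, cF Fq p.2], ![0, tF Fq, 0], ![0, 0, tF Fq]]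

/-- The family `R₂`, indexed by `a ∈ 𝔽_q`. -/
def epsR2 (a : Fq) : Matrix (Fin 3) (Fin 3) (RatFunc Fq) :=
  Matrix.of ![![0, 1, cF Fq a], ![tF Fq, 0, 0], ![0, 0, tF Fq]]

/-- The single element of `S₂`. -/
def epsS2 : Matrix (Fin 3) (Fin 3) (RatFunc Fq) :=
  Matrix.of ![![0, 0, 1], ![tF Fq, 0, 0], ![0, tF Fq, 0]]

open Polynomial in
/-- Entrywise inclusion of polynomial matrices into matrices over `F`. -/
abbrev toF : Matrix (Fin 3) (Fin 3) Fq[X] →+* Matrix (Fin 3) (Fin 3) (RatFunc Fq) :=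
  (algebraMap Fq[X] (RatFunc Fq)).mapMatrix

open Polynomial in
/-- Reduction modulo `t`. -/
abbrev redT : Matrix (Fin 3) (Fin 3) Fq[X] →+* Matrix (Fin 3) (Fin 3) Fq :=
  (evalRingHom (0 : Fq)).mapMatrix

open Polynomial in
/-- Constant matrices. -/
abbrev constM : Matrix (Fin 3) (Fin 3) Fq →+* Matrix (Fin 3) (Fin 3) Fq[X] :=
  (C : Fq →+* Fq[X]).mapMatrix

open Polynomial in
/-- The matrix `diag(1,t,t)` over `𝔽_q[t]`. -/
def deltaPoly : Matrix (Fin 3) (Fin 3) Fq[X] := Matrix.diagonal ![1, X, X]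

omit [Fintype Fq] in
theorem toF_injective : Function.Injective (toF Fq) :=
  Matrix.map_injective (RatFunc.algebraMap_injective Fq)

omit [Fintype Fq] in
theorem toF_deltaPoly : toF Fq (deltaPoly Fq) = delta2 Fq := by
  ext i j
  fin_cases i <;> fin_cases j <;> simp [deltaPoly, delta2, tF]

omit [Fintype Fq] in
theorem redT_constM (m : Matrix (Fin 3) (Fin 3) Fq) : redT Fq (constM Fq m) = m := by
  ext i j
  simp

omit [Fintype Fq] in
theorem mem_levelSet {P : Matrix (Fin 3) (Fin 3) Fq → Prop}
    {x : Matrix (Fin 3) (Fin 3) (RatFunc Fq)} :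
    x ∈ levelSet Fq P ↔ ∃ γ, IsUnit γ.det ∧ P (redT Fq γ) ∧ x = toF Fq γ :=
  Iff.rfl

open Polynomial in
omit [Fintype Fq] in
/-- If the first row of `h` is `(*,0,0)` modulo `t`, then `h` can be moved across
`diag(1,t,t)`; the entries of the resulting matrix modulo `t` are determined outside the
first row. -/
theorem exists_mul_deltaPoly_eq (h : Matrix (Fin 3) (Fin 3) Fq[X])
    (h1 : redT Fq h 0 1 = 0) (h2 : redT Fq h 0 2 = 0) :
    ∃ k : Matrix (Fin 3) (Fin 3) Fq[X], k * deltaPoly Fq = deltaPoly Fq * h ∧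
      k.det = h.det ∧ redT Fq k 0 0 = redT Fq h 0 0 ∧ redT Fq k 1 0 = 0 ∧
      redT Fq k 2 0 = 0 ∧ redT Fq k 1 1 = redT Fq h 1 1 ∧ redT Fq k 1 2 = redT Fq h 1 2 ∧
      redT Fq k 2 1 = redT Fq h 2 1 ∧ redT Fq k 2 2 = redT Fq h 2 2 := by
  obtain ⟨a, ha⟩ : X ∣ h 0 1 := by
    rw [X_dvd_iff, coeff_zero_eq_eval_zero]
    simpa using h1
  obtain ⟨b, hb⟩ : X ∣ h 0 2 := by
    rw [X_dvd_iff, coeff_zero_eq_eval_zero]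
    simpa using h2
  refine ⟨!![h 0 0, a, b; X * h 1 0, h 1 1, h 1 2; X * h 2 0, h 2 1, h 2 2], ?_, ?_, ?_⟩
  · ext1 i j
    fin_cases i <;> fin_cases j <;>
      simp [deltaPoly, Matrix.mul_diagonal, Matrix.diagonal_mul, ha, hb, mul_comm]
  · rw [Matrix.det_fin_three, Matrix.det_fin_three, ha, hb]
    simp
    ring
  · simp

open Polynomial in
omit [Fintype Fq] in
/-- Representatives `diag(1,t,t) w i`, with `w i` constant matrices in the level group, give
distinct cosets as soon as the first rows of the `w i` are pairwise non-proportional, and all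
cosets as soon as every first row is proportional to one of them. -/
theorem isDisjointCosetDecomp_levelSet_s17 {ι : Type} (P : Matrix (Fin 3) (Fin 3) Fq → Prop)
    (w v : ι → Matrix (Fin 3) (Fin 3) Fq)
    (fam : ι → Matrix (Fin 3) (Fin 3) (RatFunc Fq))
    (one : P 1) (mul : ∀ m n, P m → P n → P (m * n))
    (hvw : ∀ i, v i * w i = 1) (hw : ∀ i, P (w i)) (hv : ∀ i, P (v i))
    (hfam : ∀ i, fam i = delta2 Fq * toF Fq (constM Fq (w i)))
    (hex : ∀ m, P m → m.det ≠ 0 → ∃ i, (m * v i) 0 1 = 0 ∧ (m * v i) 0 2 = 0)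
    (hswap : ∀ m n, P m → m 0 1 = 0 → m 0 2 = 0 → n 0 0 = m 0 0 → n 1 0 = 0 → n 2 0 = 0 →
      n 1 1 = m 1 1 → n 1 2 = m 1 2 → n 2 1 = m 2 1 → n 2 2 = m 2 2 → P n)
    (hinj : ∀ i j c, (∀ l, w i 0 l = c * w j 0 l) → i = j) :
    IsDisjointCosetDecomp Fq (levelSet Fq P) (dcoset Fq (levelSet Fq P) (delta2 Fq)) fam := by
  have key : ∀ i j x, x ∈ lcoset Fq (levelSet Fq P) (fam i) →
      x ∈ lcoset Fq (levelSet Fq P) (fam j) → i = j := by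
    rintro i j x ⟨g, hg, rfl⟩ ⟨g', hg', he⟩
    obtain ⟨γ, hγ, -, rfl⟩ := (mem_levelSet Fq).1 hg
    obtain ⟨γ', -, -, rfl⟩ := (mem_levelSet Fq).1 hg'
    rw [hfam, hfam, ← toF_deltaPoly, ← map_mul, ← map_mul, ← map_mul, ← map_mul] at he
    have h1 := congrArg (fun m => redT Fq (γ⁻¹ * m)) (toF_injective Fq he)
    simp only [Matrix.nonsing_inv_mul_cancel_left _ _ hγ] at h1
    rw [← mul_assoc, map_mul, map_mul, map_mul (redT Fq) (deltaPoly Fq), redT_constM,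
      redT_constM] at h1
    refine hinj i j (redT Fq (γ⁻¹ * γ') 0 0) fun l => ?_
    have h2 := congrFun (congrFun h1 0) l
    simpa [deltaPoly, Matrix.mul_apply, Fin.sum_univ_three] using h2
  have cdet : ∀ i, IsUnit (w i).det ∧ IsUnit (v i).det := fun i => by
    have := congrArg Matrix.det (hvw i)
    rw [Matrix.det_mul, Matrix.det_one] at this
    exact ⟨IsUnit.of_mul_eq_one_right _ this, IsUnit.of_mul_eq_one _ this⟩
  have hconst : ∀ m : Matrix (Fin 3) (Fin 3) Fq, IsUnit m.det → IsUnit (constM Fq m).det := by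
    intro m hm
    rw [← RingHom.map_det]
    exact hm.map _
  have hdisj : Pairwise (Function.onFun Disjoint fun i : ι => lcoset Fq (levelSet Fq P) (fam i)) :=
    fun i j hij => Set.disjoint_left.2 fun x hi hj => hij (key i j x hi hj)
  refine ⟨Set.ext fun x => ⟨?_, ?_⟩, ?_, hdisj⟩
  · rintro ⟨g, hg, g', hg', rfl⟩
    obtain ⟨γ, hγ, hPγ, rfl⟩ := (mem_levelSet Fq).1 hg
    obtain ⟨γ', hγ', hPγ', rfl⟩ := (mem_levelSet Fq).1 hg'
    have hd : (redT Fq γ').det ≠ 0 := by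
      rw [← RingHom.map_det]
      exact (hγ'.map _).ne_zero
    obtain ⟨i, hi1, hi2⟩ := hex _ hPγ' hd
    have hr : redT Fq (γ' * constM Fq (v i)) = redT Fq γ' * v i := by
      rw [map_mul, redT_constM]
    obtain ⟨k, hk, hkd, k00, k10, k20, k11, k12, k21, k22⟩ :=
      exists_mul_deltaPoly_eq Fq (γ' * constM Fq (v i)) (by rw [hr, hi1]) (by rw [hr, hi2])
    rw [hr] at k00 k11 k12 k21 k22
    refine Set.mem_iUnion.2 ⟨i, toF Fq (γ * k), (mem_levelSet Fq).2 ⟨γ * k, ?_, ?_, rfl⟩, ?_⟩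
    · rw [Matrix.det_mul, hkd, Matrix.det_mul]
      exact hγ.mul (hγ'.mul (hconst _ (cdet i).2))
    · rw [map_mul]
      exact mul _ _ hPγ (hswap _ _ (mul _ _ hPγ' (hv i)) hi1 hi2 k00 k10 k20 k11 k12 k21 k22)
    · rw [hfam, ← toF_deltaPoly, ← map_mul, ← map_mul, ← map_mul, ← map_mul, mul_assoc γ k,
        ← mul_assoc k, hk, mul_assoc (deltaPoly Fq), mul_assoc γ', ← map_mul, hvw, map_one,
        mul_one, mul_assoc]
  · intro hx
    obtain ⟨i, g, hg, rfl⟩ := Set.mem_iUnion.1 hx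
    refine ⟨g, hg, toF Fq (constM Fq (w i)), (mem_levelSet Fq).2 ⟨_, ?_, ?_, rfl⟩, ?_⟩
    · exact hconst _ (cdet i).1
    · rw [redT_constM]
      exact hw i
    · rw [hfam, mul_assoc]
  · intro i j hij
    have hmem : fam i ∈ lcoset Fq (levelSet Fq P) (fam i) :=
      ⟨1, (mem_levelSet Fq).2 ⟨1, by simp, by rwa [map_one], (map_one _).symm⟩, (one_mul _).symm⟩
    exact key i j _ hmem (by simpa only [hij] using hmem)

/-- The constant matrix with `epsQ2 p = diag(1,t,t) wQ p`. -/
def wQ (p : Fq × Fq) : Matrix (Fin 3) (Fin 3) Fq := !![1, p.1, p.2; 0, 1, 0; 0, 0, 1]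

/-- The inverse of `wQ p`. -/
def vQ (p : Fq × Fq) : Matrix (Fin 3) (Fin 3) Fq := !![1, -p.1, -p.2; 0, 1, 0; 0, 0, 1]

/-- The constant matrix with `epsR2 a = diag(1,t,t) wR a`. -/
def wR (a : Fq) : Matrix (Fin 3) (Fin 3) Fq := !![0, 1, a; 1, 0, 0; 0, 0, 1]

/-- The inverse of `wR a`. -/
def vR (a : Fq) : Matrix (Fin 3) (Fin 3) Fq := !![0, 1, 0; 1, 0, -a; 0, 0, 1]

/-- The constant matrix with `epsS2 = diag(1,t,t) wS`. -/
def wS : Matrix (Fin 3) (Fin 3) Fq := !![0, 0, 1; 1, 0, 0; 0, 1, 0]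

/-- The inverse of `wS`. -/
def vS : Matrix (Fin 3) (Fin 3) Fq := !![0, 1, 0; 0, 0, 1; 1, 0, 0]

omit [Fintype Fq] in
theorem algebraMap_C_eq_cF (a : Fq) :
    algebraMap (Polynomial Fq) (RatFunc Fq) (Polynomial.C a) = cF Fq a :=
  (IsScalarTower.algebraMap_apply Fq (Polynomial Fq) (RatFunc Fq) a).symm

omit [Fintype Fq] in
theorem epsQ2_eq (p : Fq × Fq) : epsQ2 Fq p = delta2 Fq * toF Fq (constM Fq (wQ Fq p)) := by
  ext i j
  fin_cases i <;> fin_cases j <;>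
    simp [epsQ2, delta2, wQ, Matrix.diagonal_mul, algebraMap_C_eq_cF, -RatFunc.algebraMap_C]

omit [Fintype Fq] in
theorem epsR2_eq (a : Fq) : epsR2 Fq a = delta2 Fq * toF Fq (constM Fq (wR Fq a)) := by
  ext i j
  fin_cases i <;> fin_cases j <;>
    simp [epsR2, delta2, wR, Matrix.diagonal_mul, algebraMap_C_eq_cF, -RatFunc.algebraMap_C]

omit [Fintype Fq] in
theorem epsS2_eq : epsS2 Fq = delta2 Fq * toF Fq (constM Fq (wS Fq)) := by
  ext i j
  fin_cases i <;> fin_cases j <;> simp [epsS2, delta2, wS, Matrix.diagonal_mul]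

omit [Fintype Fq] in
theorem vQ_mul_wQ (p : Fq × Fq) : vQ Fq p * wQ Fq p = 1 := by
  ext i j
  fin_cases i <;> fin_cases j <;> simp [vQ, wQ, Matrix.mul_apply, Fin.sum_univ_three]

omit [Fintype Fq] in
theorem vR_mul_wR (a : Fq) : vR Fq a * wR Fq a = 1 := by
  ext i j
  fin_cases i <;> fin_cases j <;> simp [vR, wR, Matrix.mul_apply, Fin.sum_univ_three]

omit [Fintype Fq] in
theorem vS_mul_wS : vS Fq * wS Fq = 1 := by
  ext i j
  fin_cases i <;> fin_cases j <;> simp [vS, wS, Matrix.mul_apply, Fin.sum_univ_three]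

omit [Fintype Fq] in
theorem exists_mul_vQ (m : Matrix (Fin 3) (Fin 3) Fq) (h : m 0 0 ≠ 0) :
    ∃ p, (m * vQ Fq p) 0 1 = 0 ∧ (m * vQ Fq p) 0 2 = 0 :=
  ⟨(m 0 1 / m 0 0, m 0 2 / m 0 0), by
    constructor <;> simp [vQ, Matrix.mul_apply, Fin.sum_univ_three] <;> field_simp <;> ring⟩

omit [Fintype Fq] in
theorem exists_mul_vR (m : Matrix (Fin 3) (Fin 3) Fq) (h : m 0 0 = 0) (h' : m 0 1 ≠ 0) :
    ∃ a, (m * vR Fq a) 0 1 = 0 ∧ (m * vR Fq a) 0 2 = 0 :=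
  ⟨m 0 2 / m 0 1, by
    constructor <;> simp [vR, Matrix.mul_apply, Fin.sum_univ_three, h]
    field_simp
    ring⟩

omit [Fintype Fq] in
theorem mul_vS (m : Matrix (Fin 3) (Fin 3) Fq) (h : m 0 0 = 0) (h' : m 0 1 = 0) :
    (m * vS Fq) 0 1 = 0 ∧ (m * vS Fq) 0 2 = 0 := by
  constructor <;> simp [vS, Matrix.mul_apply, Fin.sum_univ_three, h, h']

omit [Fintype Fq] in
theorem wQ_inj (i j : Fq × Fq) (c : Fq) (h : ∀ l, wQ Fq i 0 l = c * wQ Fq j 0 l) : i = j := by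
  have h0 := h 0
  have h1 := h 1
  have h2 := h 2
  simp [wQ] at h0 h1 h2
  subst h0
  exact Prod.ext (by simpa using h1) (by simpa using h2)

omit [Fintype Fq] in
/-- The case of a level group containing all `wQ p`, whose members have nonzero upper left
entry. -/
theorem isDisjointCosetDecomp_epsQ2 (P : Matrix (Fin 3) (Fin 3) Fq → Prop)
    (one : P 1) (mul : ∀ m n, P m → P n → P (m * n))
    (hw : ∀ p, P (wQ Fq p)) (hv : ∀ p, P (vQ Fq p))
    (hne : ∀ m, P m → m.det ≠ 0 → m 0 0 ≠ 0)
    (hswap : ∀ m n, P m → m 0 1 = 0 → m 0 2 = 0 → n 0 0 = m 0 0 → n 1 0 = 0 → n 2 0 = 0 →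
      n 1 1 = m 1 1 → n 1 2 = m 1 2 → n 2 1 = m 2 1 → n 2 2 = m 2 2 → P n) :
    IsDisjointCosetDecomp Fq (levelSet Fq P) (dcoset Fq (levelSet Fq P) (delta2 Fq))
      (epsQ2 Fq) :=
  isDisjointCosetDecomp_levelSet_s17 Fq P (wQ Fq) (vQ Fq) _ one mul (vQ_mul_wQ Fq) hw hv
    (epsQ2_eq Fq) (fun m hm hd => exists_mul_vQ Fq m (hne m hm hd)) hswap (wQ_inj Fq)

omit [Fintype Fq] in
theorem isDisjointCosetDecomp_G1 :
    IsDisjointCosetDecomp Fq (G1 Fq) (dcoset Fq (G1 Fq) (delta2 Fq)) (epsQ2 Fq) := by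
  apply isDisjointCosetDecomp_epsQ2
  · simp [Fin.forall_fin_succ]
  · simp +contextual [Fin.forall_fin_succ, Matrix.mul_apply, Fin.sum_univ_three]
  · simp [Fin.forall_fin_succ, wQ]
  · simp [Fin.forall_fin_succ, vQ]
  · intro m hm _
    simp [hm.2]
  · simp +contextual [Fin.forall_fin_succ]

omit [Fintype Fq] in
theorem isDisjointCosetDecomp_G0 :
    IsDisjointCosetDecomp Fq (G0 Fq) (dcoset Fq (G0 Fq) (delta2 Fq)) (epsQ2 Fq) := by
  apply isDisjointCosetDecomp_epsQ2
  · simp [Fin.forall_fin_succ]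
  · simp +contextual [Fin.forall_fin_succ, Matrix.mul_apply, Fin.sum_univ_three]
  · simp [Fin.forall_fin_succ, wQ]
  · simp [Fin.forall_fin_succ, vQ]
  · intro m hm hd h0
    simp [Matrix.det_fin_three, h0, hm 1 0 (by decide), hm 2 0 (by decide)] at hd
  · simp +contextual [Fin.forall_fin_succ]

omit [Fintype Fq] in
theorem isDisjointCosetDecomp_G2P :
    IsDisjointCosetDecomp Fq (G2P Fq) (dcoset Fq (G2P Fq) (delta2 Fq)) (epsQ2 Fq) := by
  apply isDisjointCosetDecomp_epsQ2
  · simp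
  · simp +contextual [Matrix.mul_apply, Fin.sum_univ_three]
  · simp [wQ]
  · simp [vQ]
  · intro m hm hd h0
    simp [Matrix.det_fin_three, h0, hm.1, hm.2] at hd
  · simp +contextual

omit [Fintype Fq] in
theorem isDisjointCosetDecomp_G0P :
    IsDisjointCosetDecomp Fq (G0P Fq) (dcoset Fq (G0P Fq) (delta2 Fq))
      (Sum.elim (epsQ2 Fq) (epsR2 Fq)) := by
  apply isDisjointCosetDecomp_levelSet_s17 Fq _ (Sum.elim (wQ Fq) (wR Fq))
    (Sum.elim (vQ Fq) (vR Fq))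
  · simp
  · simp +contextual [Matrix.mul_apply, Fin.sum_univ_three]
  · rintro (p | a)
    exacts [vQ_mul_wQ Fq p, vR_mul_wR Fq a]
  · rintro (p | a) <;> simp [wQ, wR]
  · rintro (p | a) <;> simp [vQ, vR]
  · rintro (p | a)
    exacts [epsQ2_eq Fq p, epsR2_eq Fq a]
  · intro m hm hd
    by_cases h0 : m 0 0 = 0
    · have h1 : m 0 1 ≠ 0 := fun h1 => by
        simp [Matrix.det_fin_three, h0, h1, hm.1, hm.2] at hd
      obtain ⟨a, ha⟩ := exists_mul_vR Fq m h0 h1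
      exact ⟨Sum.inr a, ha⟩
    · obtain ⟨p, hp⟩ := exists_mul_vQ Fq m h0
      exact ⟨Sum.inl p, hp⟩
  · simp +contextual
  · rintro (p | a) (p' | a') c h
    · exact congrArg _ (wQ_inj Fq p p' c h)
    all_goals
      have h0 := h 0
      have h1 := h 1
      have h2 := h 2
      simp [wQ, wR] at h0 h1 h2 <;> grind

omit [Fintype Fq] in
theorem isDisjointCosetDecomp_GLA :
    IsDisjointCosetDecomp Fq (GLA Fq) (dcoset Fq (GLA Fq) (delta2 Fq))
      (Sum.elim (Sum.elim (epsQ2 Fq) (epsR2 Fq)) (fun _ : Unit => epsS2 Fq)) := by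
  apply isDisjointCosetDecomp_levelSet_s17 Fq _
    (Sum.elim (Sum.elim (wQ Fq) (wR Fq)) (fun _ : Unit => wS Fq))
    (Sum.elim (Sum.elim (vQ Fq) (vR Fq)) (fun _ : Unit => vS Fq))
  · trivial
  · intros
    trivial
  · rintro ((p | a) | u)
    exacts [vQ_mul_wQ Fq p, vR_mul_wR Fq a, vS_mul_wS Fq]
  · intros
    trivial
  · intros
    trivial
  · rintro ((p | a) | u)
    exacts [epsQ2_eq Fq p, epsR2_eq Fq a, epsS2_eq Fq]
  · intro m _ _
    by_cases h0 : m 0 0 = 0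
    · by_cases h1 : m 0 1 = 0
      · exact ⟨Sum.inr (), mul_vS Fq m h0 h1⟩
      · obtain ⟨a, ha⟩ := exists_mul_vR Fq m h0 h1
        exact ⟨Sum.inl (Sum.inr a), ha⟩
    · obtain ⟨p, hp⟩ := exists_mul_vQ Fq m h0
      exact ⟨Sum.inl (Sum.inl p), hp⟩
  · intros
    trivial
  · rintro ((p | a) | u) ((p' | a') | u') c h
    · exact congrArg _ (congrArg _ (wQ_inj Fq p p' c h))
    all_goals
      have h0 := h 0
      have h1 := h 1
      have h2 := h 2
      simp [wQ, wR, wS] at h0 h1 h2 <;> grind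

/-- Decomposition of the double coset `Γδ₂Γ` into left cosets:
for `Γ ∈ {Γ₁(t), Γ₀(t), Γ₂ᴾ}` the `q²` cosets indexed by `Q₂`; for `Γ₀ᴾ` the `q²+q`
cosets indexed by `Q₂ ∪ R₂`; for `GL_3(A)` the `q²+q+1` cosets indexed by
`Q₂ ∪ R₂ ∪ S₂`. -/
theorem hecke_coset_reps_delta2 :
    (∀ Γ ∈ ({G1 Fq, G0 Fq, G2P Fq} : Set (Set (Matrix (Fin 3) (Fin 3) (RatFunc Fq)))),
      IsDisjointCosetDecomp Fq Γ (dcoset Fq Γ (delta2 Fq)) (epsQ2 Fq)) ∧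
    IsDisjointCosetDecomp Fq (G0P Fq) (dcoset Fq (G0P Fq) (delta2 Fq))
      (Sum.elim (epsQ2 Fq) (epsR2 Fq)) ∧
    IsDisjointCosetDecomp Fq (GLA Fq) (dcoset Fq (GLA Fq) (delta2 Fq))
      (Sum.elim (Sum.elim (epsQ2 Fq) (epsR2 Fq)) (fun _ : Unit => epsS2 Fq)) := by
  refine ⟨?_, isDisjointCosetDecomp_G0P Fq, isDisjointCosetDecomp_GLA Fq⟩
  rintro Γ (rfl | rfl | rfl)
  exacts [isDisjointCosetDecomp_G1 Fq, isDisjointCosetDecomp_G0 Fq,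
    isDisjointCosetDecomp_G2P Fq]

end
end
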